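/- Let g(x) := (x+1)·log₂(x+1) − x·log₂(x) for x > 0 and g(0) := 0, where log₂ denotes the base-2 logarithm. Fix N > 0, and for n̄ > 0 set F(n̄) := g(n̄) + g(n̄ + N) − g((√((N+1)² + 4·N·n̄) − N − 1)/2) − g((√((N+1)² + 4·N·n̄) + N − 1)/2). Then F(n̄)/n̄ tends to +∞ as n̄ tends to 0 from the right. -/

import Mathlib

/-- `g x = (x+1) log₂ (x+1) - x log₂ x`, with `g 0 = 0` (automatic from
Mathlib's convention `Real.log 0 = 0`). -/
noncomputable def g (x : ℝ) : ℝ :=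
  (x + 1) * Real.logb 2 (x + 1) - x * Real.logb 2 x

/-- The entanglement-assisted capacity cost function of the additive classical
noise channel with noise variance `N`. -/
noncomputable def F (N n : ℝ) : ℝ :=
  g n + g (n + N)
    - g ((Real.sqrt ((N + 1) ^ 2 + 4 * N * n) - N - 1) / 2)
    - g ((Real.sqrt ((N + 1) ^ 2 + 4 * N * n) + N - 1) / 2)

/-- Tangent-line bound for the concave function `g`. -/
theorem mul_logb_sub_logb_le_g_sub_g {a n : ℝ} (ha : 0 < a) (hn : 0 < n) :
    (n - a) * (Real.logb 2 (n + 1) - Real.logb 2 n) ≤ g n - g a := by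
  have hlog : a * (Real.log n - Real.log a) ≤
      (a + 1) * (Real.log (n + 1) - Real.log (a + 1)) := by
    have hw : a / (a + 1) + 1 / (a + 1) = 1 := by field_simp
    have h := strictConcaveOn_log_Ioi.concaveOn.2
      (Set.mem_Ioi.2 (div_pos hn ha)) (Set.mem_Ioi.2 (one_pos (α := ℝ)))
      (by positivity) (by positivity) hw
    have harg : a / (a + 1) * (n / a) + 1 / (a + 1) * 1 = (n + 1) / (a + 1) := by
      field_simp
    simp only [smul_eq_mul, Real.log_one, mul_zero, add_zero] at h
    rw [harg, Real.log_div hn.ne' ha.ne', Real.log_div (by positivity) (by positivity)] at h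
    calc a * (Real.log n - Real.log a)
        = (a + 1) * (a / (a + 1) * (Real.log n - Real.log a)) := by field_simp
      _ ≤ _ := mul_le_mul_of_nonneg_left h (by positivity)
  have h2 : 0 < Real.log 2 := Real.log_pos one_lt_two
  have hdiff : g n - g a - (n - a) * (Real.logb 2 (n + 1) - Real.logb 2 n) =
      ((a + 1) * (Real.log (n + 1) - Real.log (a + 1)) - a * (Real.log n - Real.log a)) /
        Real.log 2 := by
    simp only [g, Real.logb]
    ring
  have := div_nonneg (sub_nonneg.2 hlog) h2.le
  linarith

theorem g_le_g {a n : ℝ} (ha : 0 < a) (han : a ≤ n) : g a ≤ g n := by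
  have hn : 0 < n := ha.trans_le han
  have hlog : Real.logb 2 n ≤ Real.logb 2 (n + 1) :=
    Real.logb_le_logb_of_le one_lt_two hn (by linarith)
  have := mul_logb_sub_logb_le_g_sub_g ha hn
  have := mul_nonneg (sub_nonneg.2 han) (sub_nonneg.2 hlog)
  linarith

/-- Logarithmic lower bound for the capacity cost function per photon. -/
theorem logb_le_F_div {N n : ℝ} (hN : 0 < N) (hn : 0 < n) :
    1 / (N + 1) * -Real.logb 2 n ≤ F N n / n := by
  set s := Real.sqrt ((N + 1) ^ 2 + 4 * N * n) with hs
  obtain ⟨a, has⟩ : ∃ a, a = (s - N - 1) / 2 := ⟨_, rfl⟩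
  have hNn : 0 < N * n := mul_pos hN hn
  have hsq : s ^ 2 = (N + 1) ^ 2 + 4 * N * n := Real.sq_sqrt (by nlinarith)
  have ha : 0 < a := by
    have : N + 1 < s := Real.lt_sqrt_of_sq_lt (by linarith)
    linarith
  have haN : a * (a + N + 1) = N * n := by
    rw [has]
    linarith
  have hgap : 1 / (N + 1) * n ≤ n - a := by
    have : a * (N + 1) ≤ N * n := by nlinarith
    rw [div_mul_eq_mul_div, div_le_iff₀ (by positivity)]
    linarith
  have han : a ≤ n := by
    have : 0 < 1 / (N + 1) * n := by positivity
    linarith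
  have hF : F N n = g n + g (n + N) - g a - g (a + N) := by
    have hb : (s + N - 1) / 2 = a + N := by
      rw [has]
      ring
    rw [F, ← hs, hb, ← has]
  have hmono : g (a + N) ≤ g (n + N) := g_le_g (by linarith) (by linarith)
  have htan := mul_logb_sub_logb_le_g_sub_g ha hn
  have hlog : Real.logb 2 n ≤ Real.logb 2 (n + 1) :=
    Real.logb_le_logb_of_le one_lt_two hn (by linarith)
  have hlog' : 0 ≤ Real.logb 2 (n + 1) := Real.logb_nonneg one_lt_two (by linarith)
  rw [le_div_iff₀ hn, hF]
  calc 1 / (N + 1) * -Real.logb 2 n * n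
      = 1 / (N + 1) * n * -Real.logb 2 n := by ring
    _ ≤ 1 / (N + 1) * n * (Real.logb 2 (n + 1) - Real.logb 2 n) := by
        gcongr
        linarith
    _ ≤ (n - a) * (Real.logb 2 (n + 1) - Real.logb 2 n) :=
        mul_le_mul_of_nonneg_right hgap (sub_nonneg.2 hlog)
    _ ≤ g n + g (n + N) - g a - g (a + N) := by linarith

/-- The entanglement-assisted classical capacity per unit cost of the additive
classical noise channel is infinite: `F n̄ / n̄ → +∞` as `n̄ → 0⁺`. -/
theorem additive_noise_EA_capacity_per_unit_cost_infinite (N : ℝ)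
    (hN : 0 < N) :
    Filter.Tendsto (fun n : ℝ => F N n / n)
      (nhdsWithin 0 (Set.Ioi 0)) Filter.atTop := by
  have hlog : Filter.Tendsto (fun n : ℝ => 1 / (N + 1) * -Real.logb 2 n)
      (nhdsWithin 0 (Set.Ioi 0)) Filter.atTop :=
    (Filter.tendsto_neg_atBot_atTop.comp
      (Real.tendsto_log_nhdsGT_zero.atBot_div_const
        (Real.log_pos one_lt_two))).const_mul_atTop (by positivity)
  refine Filter.tendsto_atTop_mono' _ ?_ hlog
  filter_upwards [self_mem_nhdsWithin] with n hn
  exact logb_le_F_div hN hn
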